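/- arXiv:2303.18146 — 6 statements merged into one kernel-verified Lean document; each statement's English description precedes it below -/
import Mathlib

section
/- Assume that the componentwise order restricts to a total order on I. Then for every g ∈ GL(m,ℂ): the matrix δ(g) satisfies δ(g)·F_{α,j} = F_{α,j} for every j ∈ {1,…,p} if and only if g·G_b = G_b for every b ∈ I. In other words, the intersection of the stabilizer in GL(n,ℂ) of the flag (F_{α,1} ⊂ ⋯ ⊂ F_{α,p−1}) with the diagonally embedded copy δ(GL(m,ℂ)) equals δ(Q), where Q is the stabilizer in GL(m,ℂ) of the chain of subspaces G_b, b ∈ I. -/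
open Submodule Matrix Module

noncomputable section

/-- The index `(k-1)m + r` (0-based: `k*m + r`) of the basis vector `χ_k(e_r)` in `ℂ^(d*m)`. -/
def toIdx (m d : ℕ) (k : Fin d) (r : Fin m) : Fin (d * m) :=
  ⟨(k : ℕ) * m + (r : ℕ), by
    have h3 : (r : ℕ) < m := r.2
    calc (k : ℕ) * m + (r : ℕ) < (k : ℕ) * m + m := by omega
      _ = ((k : ℕ) + 1) * m := by ring
      _ ≤ d * m := Nat.mul_le_mul_right m k.2⟩

theorem m_pos_of {m d : ℕ} (i : Fin (d * m)) : 0 < m := by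
  rcases Nat.eq_zero_or_pos m with h | h
  · subst h; exact absurd i.2 (by simp)
  · exact h

/-- The block-diagonal embedding `δ' : M_m(ℂ) → M_{dm}(ℂ)`, `X ↦ diag(X,…,X)`. -/
def delta' (m d : ℕ) (X : Matrix (Fin m) (Fin m) ℂ) :
    Matrix (Fin (d * m)) (Fin (d * m)) ℂ := fun i j =>
  if (i : ℕ) / m = (j : ℕ) / m then
    X ⟨(i : ℕ) % m, Nat.mod_lt _ (m_pos_of i)⟩ ⟨(j : ℕ) % m, Nat.mod_lt _ (m_pos_of j)⟩
  else 0

/-- `Fsub m d p α t` is the span of the `e_i` with `α(i) ≤ t` (`α` written 0-based,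
`t` written 1-based, so the condition is `(α i) + 1 ≤ t`);
this is `F_{α,t}`, with `F_{α,0} = 0` and `F_{α,p} = ℂ^n`. -/
def Fsub (m d p : ℕ) (α : Fin (d * m) → Fin p) (t : ℕ) : Submodule ℂ (Fin (d * m) → ℂ) :=
  Submodule.span ℂ {v | ∃ i : Fin (d * m), (α i : ℕ) + 1 ≤ t ∧ v = Pi.single i (1 : ℂ)}

/-- `β(r) = (α(r), α(m+r), …, α((d−1)m+r))`. -/
def beta (m d p : ℕ) (α : Fin (d * m) → Fin p) (r : Fin m) : Fin d → Fin p :=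
  fun k => α (toIdx m d k r)

/-- `G_b`, the span of the `e_r` with `β(r) ≤ b` (componentwise order). -/
def Gsub (m d p : ℕ) (α : Fin (d * m) → Fin p) (c : Fin d → Fin p) :
    Submodule ℂ (Fin m → ℂ) :=
  Submodule.span ℂ {v | ∃ r : Fin m, beta m d p α r ≤ c ∧ v = Pi.single r (1 : ℂ)}

theorem mem_span_single_iff {N : Type*} [Fintype N] [DecidableEq N] (P : N → Prop) (v : N → ℂ) :
    v ∈ Submodule.span ℂ {v | ∃ i : N, P i ∧ v = Pi.single i (1 : ℂ)} ↔ ∀ i, ¬ P i → v i = 0 := by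
  constructor
  · intro h i hi
    induction h using Submodule.span_induction with
    | mem x hx =>
      obtain ⟨j, hj, rfl⟩ := hx
      have : i ≠ j := fun e => hi (e ▸ hj)
      simp [this]
    | zero => rfl
    | add x y _ _ hx hy => simp [hx, hy]
    | smul a x _ hx => simp [hx]
  · intro h
    rw [pi_eq_sum_univ v]
    refine Submodule.sum_mem _ fun i _ => ?_
    by_cases hi : P i
    · refine Submodule.smul_mem _ _ (Submodule.subset_span ⟨i, hi, ?_⟩)
      ext j
      simp [Pi.single_apply, eq_comm]
    · rw [h i hi, zero_smul]
      exact Submodule.zero_mem _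

theorem map_span_single_iff {N : Type*} [Fintype N] [DecidableEq N] (P : N → Prop)
    (A : Matrix N N ℂ) (hA : Function.Injective A.mulVecLin) :
    Submodule.map A.mulVecLin (Submodule.span ℂ {v | ∃ i : N, P i ∧ v = Pi.single i (1 : ℂ)})
      = Submodule.span ℂ {v | ∃ i : N, P i ∧ v = Pi.single i (1 : ℂ)} ↔
    ∀ i j, P j → ¬ P i → A i j = 0 := by
  constructor
  · intro h i j hj hi
    have h1 : A.mulVecLin (Pi.single j 1) ∈
        Submodule.span ℂ {v | ∃ i : N, P i ∧ v = Pi.single i (1 : ℂ)} := by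
      rw [← h]
      exact Submodule.mem_map_of_mem (Submodule.subset_span ⟨j, hj, rfl⟩)
    have h2 := (mem_span_single_iff P _).1 h1 i hi
    simpa using h2
  · intro h
    apply Submodule.eq_of_le_of_finrank_eq
    · rw [Submodule.map_span_le]
      rintro _ ⟨j, hj, rfl⟩
      rw [mem_span_single_iff]
      intro i hi
      simpa using h i j hj hi
    · exact (Submodule.equivMapOfInjective _ hA _).finrank_eq.symm

theorem toIdx_surj {m d : ℕ} (i : Fin (d * m)) : ∃ k r, i = toIdx m d k r := by
  refine ⟨⟨(i : ℕ) / m, Nat.div_lt_of_lt_mul (i.2.trans_eq (mul_comm d m))⟩,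
    ⟨(i : ℕ) % m, Nat.mod_lt _ (m_pos_of i)⟩, ?_⟩
  apply Fin.ext
  simp only [toIdx]
  exact (Nat.div_add_mod' _ _).symm

theorem toIdx_div {m d : ℕ} (k : Fin d) (r : Fin m) : (toIdx m d k r : ℕ) / m = k := by
  have hm : 0 < m := r.pos
  simp only [toIdx]
  rw [mul_comm, Nat.mul_add_div hm, Nat.div_eq_of_lt r.2, add_zero]

theorem toIdx_mod {m d : ℕ} (k : Fin d) (r : Fin m) : (toIdx m d k r : ℕ) % m = r := by
  simp only [toIdx]
  rw [mul_comm, Nat.mul_add_mod, Nat.mod_eq_of_lt r.2]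

theorem delta'_toIdx {m d : ℕ} (X : Matrix (Fin m) (Fin m) ℂ) (k l : Fin d) (r s : Fin m) :
    delta' m d X (toIdx m d k r) (toIdx m d l s) = if k = l then X r s else 0 := by
  simp only [delta', toIdx_div, toIdx_mod, Fin.ext_iff]

theorem toIdx_inj {m d : ℕ} {k l : Fin d} {r s : Fin m} (h : toIdx m d k r = toIdx m d l s) :
    k = l ∧ r = s := by
  constructor
  · apply Fin.ext; rw [← toIdx_div k r, h, toIdx_div]
  · apply Fin.ext; rw [← toIdx_mod k r, h, toIdx_mod]

theorem delta'_mulVec {m d : ℕ} (X : Matrix (Fin m) (Fin m) ℂ) (v : Fin (d * m) → ℂ)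
    (k : Fin d) (r : Fin m) :
    (delta' m d X *ᵥ v) (toIdx m d k r) = (X *ᵥ fun s => v (toIdx m d k s)) r := by
  have hb : Function.Bijective (fun x : Fin d × Fin m => toIdx m d x.1 x.2) := by
    constructor
    · rintro ⟨a, b⟩ ⟨c, e⟩ h
      obtain ⟨h1, h2⟩ := toIdx_inj h
      exact Prod.ext h1 h2
    · intro i
      obtain ⟨a, b, h⟩ := toIdx_surj i
      exact ⟨(a, b), h.symm⟩
  simp only [Matrix.mulVec, dotProduct]
  rw [← hb.sum_comp, Fintype.sum_prod_type]
  simp only [delta'_toIdx]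
  rw [Finset.sum_eq_single k]
  · simp
  · intro l _ hl
    simp [hl.symm]
  · simp

theorem unit_inj {m : ℕ} (g : (Matrix (Fin m) (Fin m) ℂ)ˣ) :
    Function.Injective (Matrix.mulVecLin (g : Matrix (Fin m) (Fin m) ℂ)) := by
  intro v w h
  have h' := congrArg (fun x => (↑g⁻¹ : Matrix (Fin m) (Fin m) ℂ) *ᵥ x) h
  simpa only [Matrix.mulVecLin_apply, Matrix.mulVec_mulVec, Units.inv_mul, Matrix.one_mulVec]
    using h'

theorem delta'_inj {m d : ℕ} (g : (Matrix (Fin m) (Fin m) ℂ)ˣ) :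
    Function.Injective (Matrix.mulVecLin (delta' m d (g : Matrix (Fin m) (Fin m) ℂ))) := by
  intro v w h
  ext i
  obtain ⟨k, r, rfl⟩ := toIdx_surj i
  have : (fun s => v (toIdx m d k s)) = fun s => w (toIdx m d k s) := by
    apply unit_inj g
    ext s
    have := congrFun h (toIdx m d k s)
    simpa only [Matrix.mulVecLin_apply, delta'_mulVec] using this
  exact congrFun this r

/-- Assume the componentwise order is total on `I = range β`. For every
`g ∈ GL(m,ℂ)`, the block-diagonal matrix `δ(g)` stabilizes every `F_{α,j}` (`j = 1,…,p`)
iff `g` stabilizes every `G_b`, `b ∈ I`; i.e. `P ∩ δ(GL(m,ℂ)) = δ(Q)`. -/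
theorem stmt0 (m d p : ℕ) (hm : 0 < m) (hd : 0 < d) (hp : 0 < p)
    (α : Fin (d * m) → Fin p) (hα : Function.Surjective α)
    (htot : ∀ x ∈ Set.range (beta m d p α), ∀ y ∈ Set.range (beta m d p α),
      x ≤ y ∨ y ≤ x)
    (g : (Matrix (Fin m) (Fin m) ℂ)ˣ) :
    (∀ j : ℕ, 1 ≤ j → j ≤ p →
        Submodule.map (Matrix.mulVecLin (delta' m d (g : Matrix (Fin m) (Fin m) ℂ)))
          (Fsub m d p α j) = Fsub m d p α j) ↔
      (∀ b ∈ Set.range (beta m d p α),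
        Submodule.map (Matrix.mulVecLin (g : Matrix (Fin m) (Fin m) ℂ))
          (Gsub m d p α b) = Gsub m d p α b) := by
  unfold Fsub Gsub
  simp only [map_span_single_iff _ _ (delta'_inj g), map_span_single_iff _ _ (unit_inj g)]
  constructor
  · rintro h b - r s hs hr
    rw [Pi.le_def, not_forall] at hr
    obtain ⟨k, hk⟩ := hr
    have h1 := hs k
    have hlt : beta m d p α s k < beta m d p α r k := lt_of_le_of_lt h1 (not_le.1 hk)
    have h2 := h (beta m d p α r k) (by have := Fin.lt_def.1 hlt; omega) (Fin.is_lt _).le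
      (toIdx m d k r) (toIdx m d k s) (Fin.lt_def.1 hlt) (by simp [beta])
    simpa [delta'_toIdx] using h2
  · intro h j _ _ i i' hi' hi
    obtain ⟨k, r, rfl⟩ := toIdx_surj i
    obtain ⟨l, s, rfl⟩ := toIdx_surj i'
    rw [delta'_toIdx]
    split_ifs with hkl
    · subst hkl
      refine h _ ⟨s, rfl⟩ r s le_rfl fun hle => ?_
      have := Fin.le_def.1 (hle k)
      simp only [beta] at this
      omega
    · rfl
end
end

section
/- For every j ∈ {1,…,p}, F_{α,j} = χ_1(G_{b_{i′_1(j)}}) + ⋯ + χ_d(G_{b_{i′_d(j)}}), and this sum of subspaces is direct. (This is the second formula of Proposition 5.4(a), evaluated at the base flag.) -/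
open Submodule Matrix Module

noncomputable section

/-- The linear embedding `χ_k : ℂ^m → ℂ^(dm)` onto the `k`-th block of coordinates. -/
def chi (m d : ℕ) (k : Fin d) : (Fin m → ℂ) →ₗ[ℂ] (Fin (d * m) → ℂ) where
  toFun v i :=
    if (i : ℕ) / m = (k : ℕ) then v ⟨(i : ℕ) % m, Nat.mod_lt _ (m_pos_of i)⟩ else 0
  map_add' x y := by
    funext i
    by_cases h : (i : ℕ) / m = (k : ℕ) <;> simp [h]
  map_smul' c x := by
    funext i
    by_cases h : (i : ℕ) / m = (k : ℕ) <;> simp [h]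

/-- For `1 ≤ t ≤ q`, `Gext α b t = G_{b_t}` (`t` written 1-based); `Gext α b 0 = G_{b_0} = 0`. -/
def Gext (m d p : ℕ) (α : Fin (d * m) → Fin p) {q : ℕ} (b : Fin q → Fin d → Fin p)
    (t : ℕ) : Submodule ℂ (Fin m → ℂ) :=
  if h : 1 ≤ t ∧ t ≤ q then Gsub m d p α (b ⟨t - 1, by omega⟩) else ⊥

/-- `iP b k j = i′_k(j)`: the largest (1-based) index `i ∈ {1,…,q}` with `(b_i)_k ≤ j`
(`j` written 1-based), and `0` if there is no such index. -/
def iP {d p q : ℕ} (b : Fin q → Fin d → Fin p) (k : Fin d) (j : ℕ) : ℕ :=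
  (Finset.univ.filter fun i : Fin q => (b i k : ℕ) + 1 ≤ j).sup fun i => (i : ℕ) + 1

/-- `iN b k j = i_k(j)`: the largest (1-based) index `i ∈ {1,…,q}` with `(b_i)_k = j`
(`j` written 1-based), and `0` if there is no such index. -/
def iN {d p q : ℕ} (b : Fin q → Fin d → Fin p) (k : Fin d) (j : ℕ) : ℕ :=
  (Finset.univ.filter fun i : Fin q => (b i k : ℕ) + 1 = j).sup fun i => (i : ℕ) + 1

/-- `Dval α b t = d_t = #{r : β(r) ≤ b_t}` for `1 ≤ t ≤ q`, and `d_0 = 0`. -/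
def Dval (m d p : ℕ) (α : Fin (d * m) → Fin p) {q : ℕ} (b : Fin q → Fin d → Fin p)
    (t : ℕ) : ℕ :=
  if h : 1 ≤ t ∧ t ≤ q then
    (Finset.univ.filter fun r : Fin m =>
      ∀ k : Fin d, beta m d p α r k ≤ b ⟨t - 1, by omega⟩ k).card
  else 0

/-- `Vmap b F j = V_j = χ_1(F_{i′_1(j)}) + ⋯ + χ_d(F_{i′_d(j)})` for a (1-based) `ℕ`-indexed
chain `F` of subspaces of `ℂ^m` (with the conventions `F 0 = 0`, `F q = ℂ^m` built into the
chain). -/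
def Vmap (m : ℕ) {d p q : ℕ} (b : Fin q → Fin d → Fin p)
    (F : ℕ → Submodule ℂ (Fin m → ℂ)) (j : ℕ) : Submodule ℂ (Fin (d * m) → ℂ) :=
  ⨆ k : Fin d, Submodule.map (chi m d k) (F (iP b k j))

/-- A chain `0 = F_0 ⊆ F_1 ⊆ ⋯ ⊆ F_q = ℂ^m` with `dim F_i = d_i`, i.e. a point of the flag
variety `Fl(d_1,…,d_{q−1}; ℂ^m)` together with the conventions `F_0 = 0`, `F_q = ℂ^m`. -/
def GoodChain (m d p : ℕ) (α : Fin (d * m) → Fin p) {q : ℕ} (b : Fin q → Fin d → Fin p)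
    (F : ℕ → Submodule ℂ (Fin m → ℂ)) : Prop :=
  F 0 = ⊥ ∧ F q = ⊤ ∧ (∀ i : ℕ, i < q → F i ≤ F (i + 1)) ∧
    ∀ i : ℕ, i ≤ q → finrank ℂ (F i) = Dval m d p α b i

theorem iP_le {d p q : ℕ} (b : Fin q → Fin d → Fin p) (k : Fin d) (j : ℕ) : iP b k j ≤ q := by
  unfold iP
  apply Finset.sup_le
  intro i _
  exact i.2

theorem Gext_iP (m d p : ℕ) (α : Fin (d * m) → Fin p)
    {q : ℕ} (b : Fin q → Fin d → Fin p) (hb : StrictMono b)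
    (hrange : Set.range b = Set.range (beta m d p α)) (k : Fin d) (j : ℕ) :
    Gext m d p α b (iP b k j) = Submodule.span ℂ
      {v | ∃ r : Fin m, (α (toIdx m d k r) : ℕ) + 1 ≤ j ∧ v = Pi.single r (1 : ℂ)} := by
  apply le_antisymm
  · unfold Gext
    split_ifs with h
    · unfold Gsub
      apply Submodule.span_mono
      rintro v ⟨r, hr, rfl⟩
      refine ⟨r, ?_, rfl⟩
      have hne : (Finset.univ.filter fun i : Fin q => (b i k : ℕ) + 1 ≤ j).Nonempty := by
        by_contra hn
        rw [Finset.not_nonempty_iff_eq_empty] at hn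
        have h0 : iP b k j = 0 := by
          unfold iP
          rw [hn]
          rfl
        omega
      obtain ⟨i, hi, he⟩ := Finset.exists_mem_eq_sup _ hne (fun i : Fin q => (i : ℕ) + 1)
      have he' : iP b k j = (i : ℕ) + 1 := he
      have hi' : (⟨iP b k j - 1, by omega⟩ : Fin q) = i := by
        apply Fin.ext
        simp [he']
      rw [hi'] at hr
      have h1 : (beta m d p α r k : ℕ) ≤ b i k := hr k
      have h2 : (b i k : ℕ) + 1 ≤ j := (Finset.mem_filter.mp hi).2
      unfold beta at h1
      omega
    · exact bot_le
  · rw [Submodule.span_le]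
    rintro v ⟨r, hr, rfl⟩
    obtain ⟨i, hi⟩ : beta m d p α r ∈ Set.range b := by
      rw [hrange]
      exact ⟨r, rfl⟩
    have hmem : i ∈ (Finset.univ.filter fun i : Fin q => (b i k : ℕ) + 1 ≤ j) := by
      rw [Finset.mem_filter]
      refine ⟨Finset.mem_univ _, ?_⟩
      rw [hi]
      exact hr
    have h1 : (i : ℕ) + 1 ≤ iP b k j :=
      Finset.le_sup (f := fun i : Fin q => (i : ℕ) + 1) hmem
    have h2 := iP_le b k j
    unfold Gext
    rw [dif_pos ⟨by omega, h2⟩]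
    apply Submodule.subset_span
    refine ⟨r, ?_, rfl⟩
    rw [← hi]
    apply hb.monotone
    rw [Fin.le_def]
    simp only
    omega

theorem chi_single (m d : ℕ) (k : Fin d) (r : Fin m) :
    chi m d k (Pi.single r (1 : ℂ)) = Pi.single (toIdx m d k r) (1 : ℂ) := by
  have hm : 0 < m := lt_of_le_of_lt (Nat.zero_le _) r.2
  funext i
  simp only [chi, LinearMap.coe_mk, AddHom.coe_mk, Pi.single_apply]
  have hdm := Nat.div_add_mod (i : ℕ) m
  have key : i = toIdx m d k r ↔ (i : ℕ) / m = k ∧ (i : ℕ) % m = r := by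
    rw [Fin.ext_iff]
    simp only [toIdx]
    constructor
    · intro h
      rw [h, mul_comm]
      constructor
      · rw [Nat.mul_add_div hm, Nat.div_eq_of_lt r.2, add_zero]
      · rw [Nat.mul_add_mod, Nat.mod_eq_of_lt r.2]
    · rintro ⟨h1, h2⟩
      rw [h1, h2] at hdm
      rw [← hdm, mul_comm]
  simp only [key, Fin.ext_iff]
  split_ifs <;> first | rfl | tauto

theorem exists_toIdx (m d : ℕ) (i : Fin (d * m)) : ∃ k r, i = toIdx m d k r := by
  have hm := m_pos_of i
  refine ⟨⟨(i : ℕ) / m, Nat.div_lt_of_lt_mul (lt_of_lt_of_eq i.2 (mul_comm d m))⟩,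
    ⟨(i : ℕ) % m, Nat.mod_lt _ hm⟩, ?_⟩
  apply Fin.ext
  simp only [toIdx]
  exact (Nat.div_add_mod' _ _).symm

/-- Vectors vanishing on the `k`-th block. -/
def vanishBlock (m d : ℕ) (k : Fin d) : Submodule ℂ (Fin (d * m) → ℂ) where
  carrier := {v | ∀ i : Fin (d * m), (i : ℕ) / m = k → v i = 0}
  add_mem' := by
    intro x y hx hy i hi
    simp [hx i hi, hy i hi]
  zero_mem' := by
    intro i _
    rfl
  smul_mem' := by
    intro c x hx i hi
    simp [hx i hi]

theorem chi_indep (m d : ℕ) (S : Fin d → Submodule ℂ (Fin m → ℂ)) :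
    iSupIndep (fun k : Fin d => Submodule.map (chi m d k) (S k)) := by
  intro k
  rw [Submodule.disjoint_def]
  intro x hx hx'
  have hle : (⨆ l, ⨆ (_ : l ≠ k), Submodule.map (chi m d l) (S l)) ≤ vanishBlock m d k := by
    refine iSup₂_le ?_
    rintro l hl _ ⟨w, _, rfl⟩ i hi
    have : (i : ℕ) / m ≠ l := by
      intro h
      exact hl (Fin.ext (h.symm.trans hi))
    simp [chi, this]
  have hv := hle hx'
  obtain ⟨w, _, rfl⟩ := hx
  funext i
  by_cases hi : (i : ℕ) / m = k
  · exact hv i hi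
  · simp [chi, hi]

/-- second formula of Proposition 5.4(a) at the base flag. For every
`j ∈ {1,…,p}`, `F_{α,j} = χ_1(G_{b_{i′_1(j)}}) ⊕ ⋯ ⊕ χ_d(G_{b_{i′_d(j)}})`, and the sum is
direct. -/
theorem stmt6 (m d p : ℕ) (hm : 0 < m) (hd : 0 < d) (hp : 0 < p)
    (α : Fin (d * m) → Fin p) (hα : Function.Surjective α)
    {q : ℕ} (b : Fin q → Fin d → Fin p) (hb : StrictMono b)
    (hrange : Set.range b = Set.range (beta m d p α)) :
    ∀ j : ℕ, 1 ≤ j → j ≤ p →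
      Fsub m d p α j =
        (⨆ k : Fin d, Submodule.map (chi m d k) (Gext m d p α b (iP b k j))) ∧
      iSupIndep (fun k : Fin d =>
        Submodule.map (chi m d k) (Gext m d p α b (iP b k j))) := by
  intro j _ _
  refine ⟨?_, chi_indep m d _⟩
  simp only [Gext_iP m d p α b hb hrange]
  apply le_antisymm
  · unfold Fsub
    rw [Submodule.span_le]
    rintro v ⟨i, hi, rfl⟩
    obtain ⟨k, r, rfl⟩ := exists_toIdx m d i
    refine Submodule.mem_iSup_of_mem k ?_
    rw [← chi_single]
    exact Submodule.mem_map_of_mem (Submodule.subset_span ⟨r, hi, rfl⟩)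
  · refine iSup_le fun k => ?_
    rw [Submodule.map_span, Submodule.span_le]
    rintro _ ⟨_, ⟨r, hr, rfl⟩, rfl⟩
    rw [chi_single]
    exact Submodule.subset_span ⟨_, hr, rfl⟩
end
end

section
/- Let 0 = F_0 ⊆ F_1 ⊆ ⋯ ⊆ F_q = ℂ^m be any chain of subspaces with dim F_i = d_i for all i. For j ∈ {1,…,p} put V_j := χ_1(F_{i′_1(j)}) + ⋯ + χ_d(F_{i′_d(j)}). Then each of these sums is direct, V_1 ⊆ V_2 ⊆ ⋯ ⊆ V_p = ℂ^n, and dim V_j = #{i ∈ {1,…,n} : α(i) ≤ j} for every j ∈ {1,…,p}. (This shows the map φ of Proposition 5.4(a) is well defined and sends flags of type (d_1,…,d_{q−1}) in ℂ^m to flags of the type of (F_{α,1},…,F_{α,p−1}) in ℂ^n.) -/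
open Submodule Matrix Module

noncomputable section

theorem chi_toIdx (m d : ℕ) (k k' : Fin d) (r : Fin m) (v : Fin m → ℂ) :
    chi m d k v (toIdx m d k' r) = if k' = k then v r else 0 := by
  have hm : 0 < m := r.pos
  have h1 : ((k' : ℕ) * m + (r : ℕ)) / m = k' := by
    rw [Nat.add_comm, Nat.add_mul_div_right _ _ hm, Nat.div_eq_of_lt r.2, Nat.zero_add]
  have h2 : ((k' : ℕ) * m + (r : ℕ)) % m = r := by
    rw [Nat.add_comm, Nat.add_mul_mod_self_right, Nat.mod_eq_of_lt r.2]
  simp [chi, toIdx, h1, h2, Fin.ext_iff]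

/-- projection to the `k`-th block -/
def prK (m d : ℕ) (k : Fin d) : (Fin (d * m) → ℂ) →ₗ[ℂ] (Fin m → ℂ) :=
  LinearMap.funLeft ℂ ℂ (toIdx m d k)

theorem prK_chi (m d : ℕ) (k k' : Fin d) (v : Fin m → ℂ) :
    prK m d k' (chi m d k v) = if k' = k then v else 0 := by
  funext r
  simp only [prK, LinearMap.funLeft_apply, chi_toIdx]
  split_ifs <;> simp

theorem chi_inj (m d : ℕ) (k : Fin d) : Function.Injective (chi m d k) := by
  intro v w h
  simpa [prK_chi] using congrArg (prK m d k) h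

theorem finrank_iSup_indep {V : Type*} [AddCommGroup V] [Module ℂ V] [FiniteDimensional ℂ V]
    {d : ℕ} (S : Fin d → Submodule ℂ V) (h : iSupIndep S) :
    finrank ℂ (⨆ k, S k : Submodule ℂ V) = ∑ k, finrank ℂ (S k) := by
  rw [(LinearEquiv.ofEq _ _ (Submodule.iSup_eq_range_dfinsupp_lsum S)).finrank_eq,
    LinearMap.finrank_range_of_inj h.dfinsupp_lsum_injective]
  exact Module.finrank_directSum (R := ℂ) (fun k => S k)

theorem toIdx_bij (m d : ℕ) :
    Function.Bijective (fun x : Fin d × Fin m => toIdx m d x.1 x.2) := by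
  have : (fun x : Fin d × Fin m => toIdx m d x.1 x.2) = finProdFinEquiv := by
    funext x
    apply Fin.ext
    simp [toIdx, finProdFinEquiv, Nat.mul_comm, Nat.add_comm]
  rw [this]
  exact finProdFinEquiv.bijective

theorem lt_iP_iff {d p q : ℕ} (b : Fin q → Fin d → Fin p) (hb : StrictMono b) (k : Fin d)
    (j : ℕ) (i : Fin q) : (i : ℕ) < iP b k j ↔ (b i k : ℕ) + 1 ≤ j := by
  unfold iP
  rw [Finset.lt_sup_iff]
  constructor
  · rintro ⟨i0, h0, h1⟩
    have h2 : i ≤ i0 := by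
      rw [Fin.le_def]; omega
    have h3 : b i k ≤ b i0 k := hb.monotone h2 k
    have h4 := (Finset.mem_filter.1 h0).2
    rw [Fin.le_def] at h3
    omega
  · intro h
    exact ⟨i, by simpa using h, by omega⟩

theorem iP_mono {d p q : ℕ} (b : Fin q → Fin d → Fin p) (k : Fin d) {j j' : ℕ} (h : j ≤ j') :
    iP b k j ≤ iP b k j' := by
  apply Finset.sup_mono
  intro i hi
  simp only [Finset.mem_filter, Finset.mem_univ, true_and] at hi ⊢
  omega

theorem Dval_iP (m d p : ℕ) (α : Fin (d * m) → Fin p)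
    {q : ℕ} (b : Fin q → Fin d → Fin p) (hb : StrictMono b)
    (hrange : Set.range b = Set.range (beta m d p α)) (k : Fin d) (j : ℕ) :
    Dval m d p α b (iP b k j) =
      (Finset.univ.filter fun r : Fin m => (α (toIdx m d k r) : ℕ) + 1 ≤ j).card := by
  have key : ∀ r : Fin m, ∃ i : Fin q, b i = beta m d p α r := fun r => by
    have : beta m d p α r ∈ Set.range b := hrange ▸ Set.mem_range_self r
    exact this
  have hle := iP_le b k j
  unfold Dval
  split_ifs with h
  · congr 1
    ext r
    simp only [Finset.mem_filter, Finset.mem_univ, true_and]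
    obtain ⟨i, hi⟩ := key r
    have e1 : α (toIdx m d k r) = b i k := by rw [hi]; rfl
    rw [e1, ← lt_iP_iff b hb, ← hi]
    change b i ≤ b _ ↔ _
    rw [hb.le_iff_le, Fin.le_def]
    simp only
    omega
  · symm
    rw [Finset.card_eq_zero, Finset.filter_eq_empty_iff]
    intro r _
    obtain ⟨i, hi⟩ := key r
    have e1 : α (toIdx m d k r) = b i k := by rw [hi]; rfl
    rw [e1, ← lt_iP_iff b hb]
    omega

/-- For any chain `0 = F_0 ⊆ F_1 ⊆ ⋯ ⊆ F_q = ℂ^m` with `dim F_i = d_i`,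
the sums `V_j = χ_1(F_{i′_1(j)}) + ⋯ + χ_d(F_{i′_d(j)})` are direct,
`V_1 ⊆ ⋯ ⊆ V_p = ℂ^n`, and `dim V_j = #{i : α(i) ≤ j}` for every `j ∈ {1,…,p}`. -/
theorem stmt8 (m d p : ℕ) (hm : 0 < m) (hd : 0 < d) (hp : 0 < p)
    (α : Fin (d * m) → Fin p) (hα : Function.Surjective α)
    {q : ℕ} (b : Fin q → Fin d → Fin p) (hb : StrictMono b)
    (hrange : Set.range b = Set.range (beta m d p α))
    (F : ℕ → Submodule ℂ (Fin m → ℂ)) (hF : GoodChain m d p α b F) :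
    (∀ j : ℕ, 1 ≤ j → j ≤ p →
        iSupIndep (fun k : Fin d => Submodule.map (chi m d k) (F (iP b k j)))) ∧
    (∀ j j' : ℕ, 1 ≤ j → j ≤ j' → j' ≤ p → Vmap m b F j ≤ Vmap m b F j') ∧
    Vmap m b F p = ⊤ ∧
    (∀ j : ℕ, 1 ≤ j → j ≤ p →
        finrank ℂ (Vmap m b F j) =
          (Finset.univ.filter fun i : Fin (d * m) => (α i : ℕ) + 1 ≤ j).card) := by
  obtain ⟨-, -, hmono, hdim⟩ := hF
  have hmono' : ∀ i i' : ℕ, i ≤ i' → i' ≤ q → F i ≤ F i' := by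
    intro i i' h
    induction i', h using Nat.le_induction with
    | base => intro _; exact le_rfl
    | succ n hn ih => intro h'; exact (ih (by omega)).trans (hmono n (by omega))
  have hfin : ∀ j : ℕ, finrank ℂ (Vmap m b F j) =
      (Finset.univ.filter fun i : Fin (d * m) => (α i : ℕ) + 1 ≤ j).card := by
    intro j
    unfold Vmap
    rw [finrank_iSup_indep _ (chi_indep m d fun k => F (iP b k j))]
    have h1 : ∀ k : Fin d, finrank ℂ (Submodule.map (chi m d k) (F (iP b k j))) =
        ∑ r : Fin m, if (α (toIdx m d k r) : ℕ) + 1 ≤ j then 1 else 0 := by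
      intro k
      rw [(Submodule.equivMapOfInjective _ (chi_inj m d k) _).symm.finrank_eq, hdim _ (iP_le b k j), Dval_iP m d p α b hb hrange,
        Finset.card_filter]
    rw [Finset.sum_congr rfl fun k _ => h1 k, Finset.card_filter,
      ← Fintype.sum_prod_type' (fun k r => if (α (toIdx m d k r) : ℕ) + 1 ≤ j then 1 else 0)]
    exact (toIdx_bij m d).sum_comp (fun i => if (α i : ℕ) + 1 ≤ j then 1 else 0)
  refine ⟨fun j _ _ => chi_indep m d fun k => F (iP b k j), ?_, ?_, fun j _ _ => hfin j⟩
  · intro j j' _ h _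
    exact iSup_mono fun k => Submodule.map_mono (hmono' _ _ (iP_mono b k h) (iP_le b k j'))
  · apply Submodule.eq_top_of_finrank_eq
    rw [hfin p, Finset.filter_true_of_mem (p := fun i => (α i : ℕ) + 1 ≤ p) (fun i _ => (α i).2)]
    simp
end
end

section
/- (a) For every i ∈ {1,…,q−1} there exist k ∈ {1,…,d} and j ∈ {1,…,p} with i′_k(j) = i. (b) Consequently, the map φ sending a chain 0 = F_0 ⊆ F_1 ⊆ ⋯ ⊆ F_q = ℂ^m of subspaces with dim F_i = d_i to the tuple (V_1,…,V_p), where V_j = χ_1(F_{i′_1(j)}) + ⋯ + χ_d(F_{i′_d(j)}), is injective: if two such chains (F_i) and (F′_i) yield the same tuple (V_j), then F_i = F′_i for all i. -/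
open Submodule Matrix Module

noncomputable section

theorem iP_eq {d p q : ℕ} (b : Fin q → Fin d → Fin p) (hb : StrictMono b) (i : ℕ)
    (h1 : 1 ≤ i) (h2 : i ≤ q - 1) :
    ∃ (k : Fin d) (j : ℕ), 1 ≤ j ∧ j ≤ p ∧ iP b k j = i := by
  have hlt : b ⟨i - 1, by omega⟩ < b ⟨i, by omega⟩ := hb (by
    rw [Fin.lt_def]; show i - 1 < i; omega)
  obtain ⟨k, hk⟩ := (Pi.lt_def.1 hlt).2
  refine ⟨k, (b ⟨i - 1, by omega⟩ k : ℕ) + 1, by omega, (b ⟨i - 1, by omega⟩ k).2, ?_⟩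
  unfold iP
  apply le_antisymm
  · apply Finset.sup_le
    intro i' hi'
    have h3 := (Finset.mem_filter.1 hi').2
    by_contra hcon
    have h4 : (⟨i, by omega⟩ : Fin q) ≤ i' := by
      rw [Fin.le_def]; show i ≤ (i' : ℕ); omega
    have h5 : b ⟨i, by omega⟩ k ≤ b i' k := hb.monotone h4 k
    rw [Fin.le_def] at h5
    rw [Fin.lt_def] at hk
    omega
  · have h6 : (⟨i - 1, by omega⟩ : Fin q) ∈ Finset.univ.filter
        fun i' : Fin q => (b i' k : ℕ) + 1 ≤ (b ⟨i - 1, by omega⟩ k : ℕ) + 1 := by simp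
    have h7 := Finset.le_sup (f := fun i' : Fin q => (i' : ℕ) + 1) h6
    have h8 : i ≤ i - 1 + 1 := by omega
    exact h8.trans h7

/-- Left inverse of `chi`: projection onto the `k`-th block. -/
def blockProj (m d : ℕ) (k : Fin d) : (Fin (d * m) → ℂ) →ₗ[ℂ] (Fin m → ℂ) :=
  LinearMap.funLeft ℂ ℂ (toIdx m d k)

theorem blockProj_chi (m d : ℕ) (k l : Fin d) :
    (blockProj m d k).comp (chi m d l) = if k = l then LinearMap.id else 0 := by
  apply LinearMap.ext
  intro v
  funext r
  have hm : 0 < m := r.pos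
  have hdiv : ((k : ℕ) * m + (r : ℕ)) / m = k := by
    rw [mul_comm, Nat.mul_add_div hm, Nat.div_eq_of_lt r.2, add_zero]
  have hmod : ((k : ℕ) * m + (r : ℕ)) % m = r := by
    rw [mul_comm, Nat.mul_add_mod, Nat.mod_eq_of_lt r.2]
  by_cases h : k = l
  · subst h
    simp [blockProj, chi, toIdx, LinearMap.funLeft_apply, hdiv, hmod]
  · have h' : (k : ℕ) ≠ l := fun e => h (Fin.ext e)
    simp [blockProj, chi, toIdx, LinearMap.funLeft_apply, hdiv, h, h']

theorem map_blockProj_Vmap (m : ℕ) {d p q : ℕ} (b : Fin q → Fin d → Fin p)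
    (F : ℕ → Submodule ℂ (Fin m → ℂ)) (j : ℕ) (k : Fin d) :
    Submodule.map (blockProj m d k) (Vmap m b F j) = F (iP b k j) := by
  unfold Vmap
  rw [Submodule.map_iSup]
  apply le_antisymm
  · apply iSup_le
    intro l
    rw [← Submodule.map_comp, blockProj_chi]
    by_cases h : k = l
    · subst h; simp
    · simp [h]
  · refine le_trans ?_ (le_iSup _ k)
    rw [← Submodule.map_comp, blockProj_chi]
    simp

/-- (a) Every `i ∈ {1,…,q−1}` is of the form `i′_k(j)` for some colour `k`
and some `j ∈ {1,…,p}`. (b) Consequently the map `φ : (F_i) ↦ (V_j)`,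
`V_j = χ_1(F_{i′_1(j)}) + ⋯ + χ_d(F_{i′_d(j)})`, is injective on chains
`0 = F_0 ⊆ ⋯ ⊆ F_q = ℂ^m` with `dim F_i = d_i`. -/
theorem stmt9 (m d p : ℕ) (hm : 0 < m) (hd : 0 < d) (hp : 0 < p)
    (α : Fin (d * m) → Fin p) (hα : Function.Surjective α)
    {q : ℕ} (b : Fin q → Fin d → Fin p) (hb : StrictMono b)
    (hrange : Set.range b = Set.range (beta m d p α)) :
    (∀ i : ℕ, 1 ≤ i → i ≤ q - 1 →
        ∃ (k : Fin d) (j : ℕ), 1 ≤ j ∧ j ≤ p ∧ iP b k j = i) ∧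
    (∀ F F' : ℕ → Submodule ℂ (Fin m → ℂ),
        GoodChain m d p α b F → GoodChain m d p α b F' →
        (∀ j : ℕ, 1 ≤ j → j ≤ p → Vmap m b F j = Vmap m b F' j) →
        ∀ i : ℕ, i ≤ q → F i = F' i) := by
  refine ⟨fun i h1 h2 => iP_eq b hb i h1 h2, ?_⟩
  intro F F' hF hF' hV i hi
  rcases Nat.eq_zero_or_pos i with h0 | h0
  · subst h0
    rw [hF.1, hF'.1]
  · rcases Nat.eq_or_lt_of_le hi with hq | hq
    · subst hq
      rw [hF.2.1, hF'.2.1]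
    · obtain ⟨k, j, hj1, hj2, hk⟩ := iP_eq b hb i h0 (by omega)
      rw [← hk, ← map_blockProj_Vmap m b F j k, ← map_blockProj_Vmap m b F' j k, hV j hj1 hj2]
end
end

section
/- Assume q ≥ 2. For each j ∈ {1,…,p}, the intersection, taken over all chains 0 = F_0 ⊆ F_1 ⊆ ⋯ ⊆ F_q = ℂ^m of subspaces with dim F_i = d_i, of the subspace V_j := χ_1(F_{i′_1(j)}) + ⋯ + χ_d(F_{i′_d(j)}) equals the direct sum of the subspaces χ_k(ℂ^m) over those k ∈ {1,…,d} with i′_k(j) = q. (This computes the constant subspaces C_j(φ) of the embedding φ of Proposition 5.4, as in Remark 5.5.) -/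
open Submodule Matrix Module

noncomputable section

def blk (m d : ℕ) (k : Fin d) : (Fin (d * m) → ℂ) →ₗ[ℂ] (Fin m → ℂ) where
  toFun x r := x (toIdx m d k r)
  map_add' x y := rfl
  map_smul' c x := rfl

theorem blk_chi (m d : ℕ) (k k' : Fin d) (v : Fin m → ℂ) :
    blk m d k (chi m d k' v) = if k = k' then v else 0 := by
  funext r
  have hm : 0 < m := lt_of_le_of_lt (Nat.zero_le _) r.2
  have h1 : ((k : ℕ) * m + (r : ℕ)) / m = k := by
    rw [Nat.add_comm, Nat.add_mul_div_right _ _ hm, Nat.div_eq_of_lt r.2, zero_add]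
  have h2 : ((k : ℕ) * m + (r : ℕ)) % m = r := by
    rw [Nat.add_comm, Nat.add_mul_mod_self_right, Nat.mod_eq_of_lt r.2]
  simp only [blk, chi, toIdx, LinearMap.coe_mk, AddHom.coe_mk, h1, h2]
  by_cases h : k = k'
  · simp [h]
  · have : (k : ℕ) ≠ k' := fun e => h (Fin.ext e)
    simp [h, this]

theorem sum_chi_blk (m d : ℕ) (x : Fin (d * m) → ℂ) :
    ∑ k, chi m d k (blk m d k x) = x := by
  funext i
  have hm := m_pos_of i
  have hi : (i : ℕ) / m < d := Nat.div_lt_of_lt_mul (i.2.trans_eq (mul_comm d m))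
  rw [Finset.sum_apply, Finset.sum_eq_single (⟨(i : ℕ) / m, hi⟩ : Fin d)]
  · simp only [blk, chi, toIdx, LinearMap.coe_mk, AddHom.coe_mk, if_true]
    congr 1
    apply Fin.ext
    exact Nat.div_add_mod' _ _
  · intro k _ hk
    have : (i : ℕ) / m ≠ k := fun e => hk (Fin.ext e.symm)
    simp [chi, this]
  · simp

theorem mem_iSup_chi (m d : ℕ) (A : Fin d → Submodule ℂ (Fin m → ℂ)) (x : Fin (d * m) → ℂ) :
    x ∈ (⨆ k, Submodule.map (chi m d k) (A k)) ↔ ∀ k, blk m d k x ∈ A k := by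
  constructor
  · intro hx k
    have hle : (⨆ k, Submodule.map (chi m d k) (A k)) ≤ (A k).comap (blk m d k) := by
      refine iSup_le fun k' => ?_
      rintro _ ⟨v, hv, rfl⟩
      rw [Submodule.mem_comap, blk_chi]
      split_ifs with h
      · subst h; exact hv
      · exact zero_mem _
    exact hle hx
  · intro h
    rw [← sum_chi_blk m d x]
    exact Submodule.sum_mem _ fun k _ =>
      Submodule.mem_iSup_of_mem k (Submodule.mem_map_of_mem (h k))

theorem finrank_Gsub (m d p : ℕ) (α : Fin (d * m) → Fin p) (c : Fin d → Fin p) :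
    finrank ℂ (Gsub m d p α c) =
      (Finset.univ.filter fun r : Fin m => ∀ k : Fin d, beta m d p α r k ≤ c k).card := by
  have hset : {v : Fin m → ℂ | ∃ r : Fin m, beta m d p α r ≤ c ∧ v = Pi.single r (1 : ℂ)} =
      Set.range (fun r : {r : Fin m // ∀ k : Fin d, beta m d p α r k ≤ c k} =>
        (Pi.single r.1 (1 : ℂ) : Fin m → ℂ)) := by
    ext v
    constructor
    · rintro ⟨r, hr, rfl⟩; exact ⟨⟨r, hr⟩, rfl⟩
    · rintro ⟨r, rfl⟩; exact ⟨r.1, r.2, rfl⟩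
  have hli : LinearIndependent ℂ (fun r : {r : Fin m // ∀ k : Fin d, beta m d p α r k ≤ c k} =>
        (Pi.single r.1 (1 : ℂ) : Fin m → ℂ)) :=
    (Pi.linearIndependent_single_one (Fin m) ℂ).comp _ Subtype.val_injective
  rw [Gsub, hset, finrank_span_eq_card hli, Fintype.card_subtype]

theorem good_Gext (m d p : ℕ) (α : Fin (d * m) → Fin p)
    {q : ℕ} (b : Fin q → Fin d → Fin p) (hb : StrictMono b)
    (hrange : Set.range b = Set.range (beta m d p α)) (hq : 2 ≤ q) :
    GoodChain m d p α b (Gext m d p α b) := by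
  refine ⟨by simp [Gext], ?_, ?_, ?_⟩
  · have : 1 ≤ q ∧ q ≤ q := by omega
    rw [Gext, dif_pos this, eq_top_iff]
    intro x _
    rw [pi_eq_sum_univ' x]
    refine Submodule.sum_mem _ fun r _ => Submodule.smul_mem _ _ (Submodule.subset_span ?_)
    refine ⟨r, ?_, ?_⟩
    · obtain ⟨i, hi⟩ : beta m d p α r ∈ Set.range b := hrange ▸ ⟨r, rfl⟩
      rw [← hi]
      apply hb.monotone
      rw [Fin.le_def]
      have := i.2
      simp only
      omega
    · funext j; simp [Pi.single_apply]
  · intro i hi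
    by_cases h0 : 1 ≤ i
    · rw [Gext, Gext, dif_pos ⟨h0, hi.le⟩, dif_pos ⟨by omega, by omega⟩]
      apply Submodule.span_mono
      rintro v ⟨r, hr, rfl⟩
      refine ⟨r, hr.trans (hb.monotone ?_), rfl⟩
      rw [Fin.le_def]
      simp
    · rw [Gext, dif_neg (by omega)]
      exact bot_le
  · intro i hi
    by_cases h : 1 ≤ i ∧ i ≤ q
    · rw [Gext, Dval, dif_pos h, dif_pos h, finrank_Gsub]
    · rw [Gext, Dval, dif_neg h, dif_neg h, finrank_bot]

theorem Gext_ne_top (m d p : ℕ) (hm : 0 < m) (α : Fin (d * m) → Fin p)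
    {q : ℕ} (b : Fin q → Fin d → Fin p) (hb : StrictMono b)
    (hrange : Set.range b = Set.range (beta m d p α)) (i : ℕ) (hi : i < q) :
    Gext m d p α b i ≠ ⊤ := by
  intro htop
  have hfr : finrank ℂ (Gext m d p α b i) = m := by rw [htop, finrank_top]; simp
  by_cases h : 1 ≤ i ∧ i ≤ q
  · rw [Gext, dif_pos h, finrank_Gsub] at hfr
    obtain ⟨r, hr⟩ : b ⟨i, hi⟩ ∈ Set.range (beta m d p α) := hrange ▸ ⟨_, rfl⟩
    have hall := (Finset.card_eq_iff_eq_univ _).1 (hfr.trans (Fintype.card_fin m).symm)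
    have hmem : r ∈ (Finset.univ : Finset (Fin m)) := Finset.mem_univ r
    rw [← hall, Finset.mem_filter] at hmem
    have hle : beta m d p α r ≤ b ⟨i - 1, by omega⟩ := hmem.2
    rw [hr, hb.le_iff_le, Fin.le_def] at hle
    simp only at hle
    omega
  · rw [Gext, dif_neg h, finrank_bot] at hfr
    omega

theorem good_map (m d p : ℕ) (α : Fin (d * m) → Fin p)
    {q : ℕ} (b : Fin q → Fin d → Fin p) (F : ℕ → Submodule ℂ (Fin m → ℂ))
    (g : (Fin m → ℂ) ≃ₗ[ℂ] (Fin m → ℂ)) (hF : GoodChain m d p α b F) :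
    GoodChain m d p α b (fun i => (F i).map (g : (Fin m → ℂ) →ₗ[ℂ] (Fin m → ℂ))) := by
  obtain ⟨h0, h1, h2, h3⟩ := hF
  refine ⟨by simp [h0], ?_, fun i hi => Submodule.map_mono (h2 i hi), fun i hi => ?_⟩
  · simp only [h1, Submodule.map_top]
    exact LinearMap.range_eq_top.2 g.surjective
  · rw [← h3 i hi]
    exact LinearEquiv.finrank_map_eq g (F i)

/-- Remark 5.5. Assume `q ≥ 2`. For each `j ∈ {1,…,p}`, the intersection
over all chains `0 = F_0 ⊆ ⋯ ⊆ F_q = ℂ^m` with `dim F_i = d_i` of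
`V_j = χ_1(F_{i′_1(j)}) + ⋯ + χ_d(F_{i′_d(j)})` equals the (direct) sum of the
blocks `χ_k(ℂ^m)` over those `k` with `i′_k(j) = q`. -/
theorem stmt10 (m d p : ℕ) (hm : 0 < m) (hd : 0 < d) (hp : 0 < p)
    (α : Fin (d * m) → Fin p) (hα : Function.Surjective α)
    {q : ℕ} (b : Fin q → Fin d → Fin p) (hb : StrictMono b)
    (hrange : Set.range b = Set.range (beta m d p α)) (hq : 2 ≤ q) :
    ∀ j : ℕ, 1 ≤ j → j ≤ p →
      (⨅ F : {F : ℕ → Submodule ℂ (Fin m → ℂ) // GoodChain m d p α b F},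
          Vmap m b F.1 j) =
        ⨆ (k : Fin d) (_ : iP b k j = q), Submodule.map (chi m d k) ⊤ := by
  intro j _ _
  have hR : (⨆ (k : Fin d) (_ : iP b k j = q), Submodule.map (chi m d k) ⊤) =
      ⨆ k : Fin d, Submodule.map (chi m d k) (⨆ (_ : iP b k j = q), ⊤) := by
    simp only [Submodule.map_iSup]
  ext x
  rw [hR, mem_iSup_chi, Submodule.mem_iInf]
  simp only [Vmap, mem_iSup_chi]
  constructor
  · intro h k
    by_cases hk : iP b k j = q
    · simp [hk]
    · have hlt : iP b k j < q := lt_of_le_of_ne (iP_le b k j) hk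
      have hx0 : blk m d k x = 0 := by
        by_contra hne
        obtain ⟨y, hy⟩ : ∃ y, y ∉ Gext m d p α b (iP b k j) := by
          by_contra hcon
          push Not at hcon
          exact Gext_ne_top m d p hm α b hb hrange _ hlt (eq_top_iff.2 fun y _ => hcon y)
        have hy0 : y ≠ 0 := by
          rintro rfl
          exact hy (zero_mem _)
        obtain ⟨g, hg⟩ := SeparatingDual.exists_continuousLinearEquiv_apply_eq (R := ℂ) hy0 hne
        have hgood := good_map m d p α b _ g.toLinearEquiv (good_Gext m d p α b hb hrange hq)
        obtain ⟨z, hz, hzx⟩ := h ⟨_, hgood⟩ k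
        have : z = y := g.injective (by rw [hg]; exact hzx)
        exact hy (this ▸ hz)
      rw [hx0]
      exact zero_mem _
  · intro h F k
    by_cases hk : iP b k j = q
    · rw [hk, F.2.2.1]; trivial
    · have := h k
      simp only [hk, iSup_false, Submodule.mem_bot] at this
      rw [this]
      exact zero_mem _
end
end

section
/- Let V, W, U be finite-dimensional complex vector spaces. If φ : Fl(p_1,…,p_k;V) → Fl(q_1,…,q_ℓ;W) and ψ : Fl(q_1,…,q_ℓ;W) → Fl(r_1,…,r_s;U) are strict standard extensions, then the composition ψ ∘ φ : Fl(p_1,…,p_k;V) → Fl(r_1,…,r_s;U) is a strict standard extension. -/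
open Submodule Module

noncomputable section

/-- Extension of a flag `V_1 ⊆ ⋯ ⊆ V_k` (written with 1-based indices) by the conventions
`V_0 = 0` and `V_{k+1} = V`. -/
def extChain {V : Type*} [AddCommGroup V] [Module ℂ V] (k : ℕ)
    (F : Fin k → Submodule ℂ V) (t : ℕ) : Submodule ℂ V :=
  if h0 : t = 0 then ⊥ else if h : t ≤ k then F ⟨t - 1, by omega⟩ else ⊤

/-- The flag variety `Fl(p_1,…,p_k; V)`: chains of subspaces `V_1 ⊆ ⋯ ⊆ V_k` of `V` with
`dim V_i = p_i`. -/
def FlagOfDim {V : Type*} [AddCommGroup V] [Module ℂ V] (k : ℕ) (pv : Fin k → ℕ) :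
    Set (Fin k → Submodule ℂ V) :=
  {F | (∀ i j : Fin k, i ≤ j → F i ≤ F j) ∧ ∀ i : Fin k, finrank ℂ (F i) = pv i}

/-- `φ : Fl(p_1,…,p_k;V) → Fl(t_1,…,t_ℓ;W)` is a *strict standard extension* if there are a
decomposition `W = V′ ⊕ Z`, a linear isomorphism `ε : V ≅ V′`, a chain `Z_1 ⊆ ⋯ ⊆ Z_ℓ` of
subspaces of `Z` and a nondecreasing `κ : {1,…,ℓ} → {0,1,…,k+1}` such that
`φ(V_1,…,V_k) = (ε(V_{κ(1)}) + Z_1, …, ε(V_{κ(ℓ)}) + Z_ℓ)` for every flag, where `V_0 = 0`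
and `V_{k+1} = V`. -/
def IsStrictStdExt {V W : Type*} [AddCommGroup V] [Module ℂ V]
    [AddCommGroup W] [Module ℂ W] (k ℓ : ℕ) (pv : Fin k → ℕ)
    (φ : (Fin k → Submodule ℂ V) → (Fin ℓ → Submodule ℂ W)) : Prop :=
  ∃ (V' Z : Submodule ℂ W) (ε : V ≃ₗ[ℂ] V') (Zc : Fin ℓ → Submodule ℂ W) (κ : Fin ℓ → ℕ),
    IsCompl V' Z ∧ (∀ j : Fin ℓ, Zc j ≤ Z) ∧ (∀ i j : Fin ℓ, i ≤ j → Zc i ≤ Zc j) ∧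
    (∀ i j : Fin ℓ, i ≤ j → κ i ≤ κ j) ∧ (∀ j : Fin ℓ, κ j ≤ k + 1) ∧
    ∀ F ∈ FlagOfDim (V := V) k pv, ∀ j : Fin ℓ,
      φ F j = Submodule.map (V'.subtype.comp ε.toLinearMap) (extChain k F (κ j)) ⊔ Zc j

/-- A convenient way to produce a strict standard extension from an injective linear map. -/
theorem isStrictStdExt_of_injective {V W : Type*} [AddCommGroup V] [Module ℂ V]
    [AddCommGroup W] [Module ℂ W] (k l : ℕ) (pv : Fin k → ℕ)
    (φ : (Fin k → Submodule ℂ V) → (Fin l → Submodule ℂ W))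
    (f : V →ₗ[ℂ] W) (hf : Function.Injective f) (Z : Submodule ℂ W)
    (Zc : Fin l → Submodule ℂ W) (κ : Fin l → ℕ)
    (h1 : IsCompl (LinearMap.range f) Z) (h2 : ∀ j, Zc j ≤ Z)
    (h3 : ∀ i j : Fin l, i ≤ j → Zc i ≤ Zc j) (h4 : ∀ i j : Fin l, i ≤ j → κ i ≤ κ j)
    (h5 : ∀ j, κ j ≤ k + 1)
    (h6 : ∀ F ∈ FlagOfDim (V := V) k pv, ∀ j : Fin l,
      φ F j = Submodule.map f (extChain k F (κ j)) ⊔ Zc j) :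
    IsStrictStdExt k l pv φ :=
  ⟨LinearMap.range f, Z, LinearEquiv.ofInjective f hf, Zc, κ, h1, h2, h3, h4, h5, h6⟩

theorem isCompl_range_comp {V W U : Type*} [AddCommGroup V] [Module ℂ V]
    [AddCommGroup W] [Module ℂ W] [AddCommGroup U] [Module ℂ U]
    (f : V →ₗ[ℂ] W) (g : W →ₗ[ℂ] U) (hg : Function.Injective g)
    (Z : Submodule ℂ W) (Y : Submodule ℂ U)
    (hZ : IsCompl (LinearMap.range f) Z) (hY : IsCompl (LinearMap.range g) Y) :
    IsCompl (LinearMap.range (g.comp f)) (Submodule.map g Z ⊔ Y) := by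
  have e : LinearMap.range (g.comp f) ⊔ Submodule.map g Z = LinearMap.range g := by
    rw [LinearMap.range_comp, ← Submodule.map_sup, hZ.sup_eq_top, Submodule.map_top]
  constructor
  · apply Disjoint.disjoint_sup_right_of_disjoint_sup_left
    · rw [LinearMap.range_comp, disjoint_iff, ← Submodule.map_inf g hg, hZ.inf_eq_bot,
        Submodule.map_bot]
    · rw [e]; exact hY.disjoint
  · rw [codisjoint_iff, ← sup_assoc, e, hY.sup_eq_top]

/-- A composition of strict standard extensions of flag varieties is a
strict standard extension. -/
theorem stmt12 {V W U : Type*}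
    [AddCommGroup V] [Module ℂ V] [FiniteDimensional ℂ V]
    [AddCommGroup W] [Module ℂ W] [FiniteDimensional ℂ W]
    [AddCommGroup U] [Module ℂ U] [FiniteDimensional ℂ U]
    (k l s : ℕ) (pv : Fin k → ℕ) (qv : Fin l → ℕ) (rv : Fin s → ℕ)
    (hpmono : StrictMono pv) (hpv : ∀ i : Fin k, 0 < pv i ∧ pv i < finrank ℂ V)
    (hqmono : StrictMono qv) (hqv : ∀ i : Fin l, 0 < qv i ∧ qv i < finrank ℂ W)
    (hrmono : StrictMono rv) (hrv : ∀ i : Fin s, 0 < rv i ∧ rv i < finrank ℂ U)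
    (φ : (Fin k → Submodule ℂ V) → (Fin l → Submodule ℂ W))
    (ψ : (Fin l → Submodule ℂ W) → (Fin s → Submodule ℂ U))
    (hφmap : ∀ F ∈ FlagOfDim (V := V) k pv, φ F ∈ FlagOfDim (V := W) l qv)
    (hψmap : ∀ G ∈ FlagOfDim (V := W) l qv, ψ G ∈ FlagOfDim (V := U) s rv)
    (hφ : IsStrictStdExt k l pv φ) (hψ : IsStrictStdExt l s qv ψ) :
    IsStrictStdExt k s pv (fun F => ψ (φ F)) := by
  obtain ⟨V', Z, ε, Zc, κ, h1, h2, h3, h4, h5, h6⟩ := hφ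
  obtain ⟨W', Y, δ, Yc, μ, g1, g2, g3, g4, g5, g6⟩ := hψ
  have hf : Function.Injective (V'.subtype.comp ε.toLinearMap) :=
    V'.injective_subtype.comp ε.injective
  have hg : Function.Injective (W'.subtype.comp δ.toLinearMap) :=
    W'.injective_subtype.comp δ.injective
  have rf : LinearMap.range (V'.subtype.comp ε.toLinearMap) = V' := by
    rw [LinearMap.range_comp, LinearEquiv.range, Submodule.map_top, Submodule.range_subtype]
  have rg : LinearMap.range (W'.subtype.comp δ.toLinearMap) = W' := by
    rw [LinearMap.range_comp, LinearEquiv.range, Submodule.map_top, Submodule.range_subtype]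
  generalize V'.subtype.comp ε.toLinearMap = f at *
  generalize W'.subtype.comp δ.toLinearMap = g at *
  subst rf rg
  let K : ℕ → ℕ := fun t =>
    if h0 : t = 0 then 0 else if h : t ≤ l then κ ⟨t - 1, by omega⟩ else k + 1
  let C : ℕ → Submodule ℂ W := fun t =>
    if h0 : t = 0 then ⊥ else if h : t ≤ l then Zc ⟨t - 1, by omega⟩ else Z
  have K5 : ∀ t, K t ≤ k + 1 := by
    intro t
    simp only [K]
    split_ifs
    · omega
    · exact h5 _
    · exact le_rfl
  have C2 : ∀ t, C t ≤ Z := by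
    intro t
    simp only [C]
    split_ifs
    · exact bot_le
    · exact h2 _
    · exact le_rfl
  have Km : ∀ a b, a ≤ b → K a ≤ K b := by
    intro a b hab
    by_cases ha : a = 0
    · simp [K, ha]
    by_cases hb : b ≤ l
    · have hb0 : b ≠ 0 := by omega
      have hal : a ≤ l := by omega
      simp only [K, ha, hb0, hal, hb, dif_pos, dif_neg, not_false_eq_true]
      apply h4
      rw [Fin.mk_le_mk]
      omega
    · have hb0 : b ≠ 0 := by omega
      have : K b = k + 1 := by simp only [K, hb0, hb, dif_neg, not_false_eq_true]
      rw [this]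
      exact K5 a
  have Cm : ∀ a b, a ≤ b → C a ≤ C b := by
    intro a b hab
    by_cases ha : a = 0
    · simp [C, ha]
    by_cases hb : b ≤ l
    · have hb0 : b ≠ 0 := by omega
      have hal : a ≤ l := by omega
      simp only [C, ha, hb0, hal, hb, dif_pos, dif_neg, not_false_eq_true]
      apply h3
      rw [Fin.mk_le_mk]
      omega
    · have hb0 : b ≠ 0 := by omega
      have : C b = Z := by simp only [C, hb0, hb, dif_neg, not_false_eq_true]
      rw [this]
      exact C2 a
  have key : ∀ F ∈ FlagOfDim (V := V) k pv, ∀ t,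
      extChain l (φ F) t = Submodule.map f (extChain k F (K t)) ⊔ C t := by
    intro F hF t
    by_cases ht : t = 0
    · simp [extChain, K, C, ht]
    by_cases hl : t ≤ l
    · have e1 : extChain l (φ F) t = φ F ⟨t - 1, by omega⟩ := by simp [extChain, ht, hl]
      have e2 : K t = κ ⟨t - 1, by omega⟩ := by simp [K, ht, hl]
      have e3 : C t = Zc ⟨t - 1, by omega⟩ := by simp [C, ht, hl]
      rw [e1, e2, e3, h6 F hF]
    · have e1 : extChain l (φ F) t = ⊤ := by simp [extChain, ht, hl]
      have e2 : K t = k + 1 := by simp [K, ht, hl]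
      have e3 : C t = Z := by simp [C, ht, hl]
      have e4 : extChain k F (k + 1) = ⊤ := by simp [extChain]
      rw [e1, e2, e3, e4, Submodule.map_top, h1.sup_eq_top]
  refine isStrictStdExt_of_injective k s pv _ (g.comp f) (hg.comp hf) (Submodule.map g Z ⊔ Y)
    (fun j => Submodule.map g (C (μ j)) ⊔ Yc j) (fun j => K (μ j))
    (isCompl_range_comp f g hg Z Y h1 g1) ?_ ?_ ?_ (fun j => K5 _) ?_
  · exact fun j => sup_le_sup (Submodule.map_mono (C2 _)) (g2 j)
  · exact fun i j hij => sup_le_sup (Submodule.map_mono (Cm _ _ (g4 i j hij))) (g3 i j hij)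
  · exact fun i j hij => Km _ _ (g4 i j hij)
  · intro F hF j
    change ψ (φ F) j = _
    rw [g6 (φ F) (hφmap F hF) j, key F hF, Submodule.map_sup, Submodule.map_comp, sup_assoc]
end
end
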